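/- arXiv:1406.6194 — 2 statements merged into one kernel-verified Lean document; each statement's English description precedes it below -/
import Mathlib

section
/- Let Ω ⊆ ℝ^n be open and let f : Ω → ℝ^n be an injective map such that f is Lipschitz and its inverse f⁻¹ : f(Ω) → Ω is Lipschitz. Let A ⊆ Ω be a Lebesgue-measurable set such that f(A) is Lebesgue-measurable, and let q ∈ A. Then q is a full-density point of A if and only if f(q) is a full-density point of f(A); that is, λ(A ∩ B(q,r))/λ(B(q,r)) → 1 as r → 0⁺ if and only if λ(f(A) ∩ B(f(q),r))/λ(B(f(q),r)) → 1 as r → 0⁺. -/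
open MeasureTheory Filter Topology Metric

section LipschitzDegree

variable {E : Type*} [NormedAddCommGroup E]

theorem exists_lipschitzOnWith_of_bounded_of_small_dist {X F : Type*} [PseudoMetricSpace X]
    [NormedAddCommGroup F] {u : X → F} {w : Set X} {K M δ : ℝ} (hδ : 0 < δ)
    (hM : ∀ x ∈ w, ‖u x‖ ≤ M)
    (h : ∀ x ∈ w, ∀ y ∈ w, dist x y < δ → dist (u x) (u y) ≤ K * dist x y) :
    ∃ C : NNReal, LipschitzOnWith C u w := by
  refine ⟨(max K (2 * M / δ)).toNNReal, LipschitzOnWith.of_dist_le' fun x hx y hy => ?_⟩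
  rcases lt_or_ge (dist x y) δ with hxy | hxy
  · exact (h x hx y hy hxy).trans (mul_le_mul_of_nonneg_right (le_max_left _ _) dist_nonneg)
  · have h1 : dist (u x) (u y) ≤ 2 * M := by
      rw [dist_eq_norm]
      linarith [norm_sub_le (u x) (u y), hM x hx, hM y hy]
    have h2 : 0 ≤ 2 * M / δ := div_nonneg (dist_nonneg.trans h1) hδ.le
    calc dist (u x) (u y) ≤ 2 * M / δ * δ := by rwa [div_mul_cancel₀ _ hδ.ne']
      _ ≤ 2 * M / δ * dist x y := mul_le_mul_of_nonneg_left hxy h2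
      _ ≤ _ := mul_le_mul_of_nonneg_right (le_max_right _ _) dist_nonneg

variable [NormedSpace ℝ E]

theorem exists_pos_forall_det_one_add_pos :
    ∃ δ > 0, ∀ A : E →L[ℝ] E, ‖A‖ < δ → 0 < (1 + A).det := by
  have hc : Continuous fun A : E →L[ℝ] E => (1 + A).det :=
    ContinuousLinearMap.continuous_det.comp (continuous_const.add continuous_id)
  have h0 : (0 : ℝ) < (1 + (0 : E →L[ℝ] E)).det := by
    rw [add_zero]; simp [ContinuousLinearMap.det]
  obtain ⟨δ, hδ, h⟩ := Metric.eventually_nhds_iff.1 (hc.continuousAt.eventually (lt_mem_nhds h0))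
  exact ⟨δ, hδ, fun A hA => h (by simpa using hA)⟩

variable [FiniteDimensional ℝ E]

theorem exists_forall_abs_det_le (C : ℝ) :
    ∃ M, ∀ A : E →L[ℝ] E, ‖A‖ ≤ C → |A.det| ≤ M := by
  obtain ⟨M, hM⟩ := (isCompact_closedBall (0 : E →L[ℝ] E) C).exists_bound_of_continuousOn
    (f := fun A : E →L[ℝ] E => A.det) ContinuousLinearMap.continuous_det.continuousOn
  exact ⟨M, fun A hA => by simpa using hM A (by simpa using hA)⟩

theorem det_eq_sum_det_one_add_smul {s : Finset ℝ}
    (hs : s.card = Module.finrank ℝ E + 1) (A : E →ₗ[ℝ] E) :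
    LinearMap.det A =
      ∑ t ∈ s, LinearMap.det (1 + t • A) / ∏ u ∈ s.erase t, (t - u) := by
  classical
  let b := Module.finBasis ℝ E
  let M := LinearMap.toMatrix b b A
  let P := ((Polynomial.X : Polynomial ℝ) • M.map Polynomial.C +
    (1 : Matrix (Fin (Module.finrank ℝ E)) (Fin (Module.finrank ℝ E)) ℝ).map Polynomial.C).det
  have hdeg : P.degree < s.card := by
    rw [hs, Polynomial.degree_lt_iff_coeff_zero]
    intro m hm
    refine Polynomial.coeff_eq_zero_of_natDegree_lt (lt_of_le_of_lt
      (Polynomial.natDegree_det_X_add_C_le M 1) ?_)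
    rw [Fintype.card_fin]
    omega
  have h := Lagrange.coeff_eq_sum (v := (id : ℝ → ℝ)) (Set.injOn_id _) hdeg
  have hc : P.coeff (s.card - 1) = LinearMap.det A := by
    have := Polynomial.coeff_det_X_add_C_card M 1
    rw [Fintype.card_fin] at this
    rw [hs, Nat.add_sub_cancel, ← LinearMap.det_toMatrix b, this]
  rw [← hc, h]
  refine Finset.sum_congr rfl fun t _ => ?_
  congr 1
  rw [← LinearMap.det_toMatrix b, id, ← Polynomial.coe_evalRingHom, RingHom.map_det]
  congr 1
  ext i j
  simp [M, Matrix.one_apply, LinearMap.toMatrix_one, add_comm]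
  split_ifs <;> simp [mul_comm]

theorem det_add_comp_smulRight (A : E →L[ℝ] E) (l : E →L[ℝ] ℝ) (v : E) :
    (A + (l.comp A).smulRight v).det = (1 + l v) * A.det := by
  have h : ((A + (l.comp A).smulRight v : E →L[ℝ] E) : E →ₗ[ℝ] E) =
      (LinearMap.transvection (l : E →ₗ[ℝ] ℝ) v) ∘ₗ (A : E →ₗ[ℝ] E) := by
    ext x
    simp [LinearMap.transvection.apply]
  rw [ContinuousLinearMap.det, h, LinearMap.det_comp, LinearMap.transvection.det]
  rfl

variable [MeasurableSpace E] (μ : Measure E)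

theorem integrableOn_det {C : ℝ} {L : E → E →L[ℝ] E} (hL : Measurable L)
    (hC : ∀ x, ‖L x‖ ≤ C) {s : Set E} (hs : μ s ≠ ⊤) :
    IntegrableOn (fun x => (L x).det) s μ := by
  obtain ⟨M, hM⟩ := exists_forall_abs_det_le (E := E) C
  exact Measure.integrableOn_of_bounded (M := M) hs
    (ContinuousLinearMap.continuous_det.measurable.comp hL).aestronglyMeasurable
    (ae_of_all _ fun x => hM _ (hC x))

variable [BorelSpace E] [μ.IsAddHaarMeasure]

theorem LipschitzOnWith.addHaar_image_le {K : NNReal} {f : E → E} {s : Set E}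
    (h : LipschitzOnWith K f s) :
    μ (f '' s) ≤ (K : ENNReal) ^ Module.finrank ℝ E * μ s := by
  have h0 := h.hausdorffMeasure_image_le (d := Module.finrank ℝ E) (by positivity)
  rw [ENNReal.rpow_natCast] at h0
  have e := Measure.isAddLeftInvariant_eq_smul μ
    (Measure.hausdorffMeasure (Module.finrank ℝ E : ℝ) : Measure E)
  rw [e, Measure.smul_apply, Measure.smul_apply, ENNReal.smul_def, ENNReal.smul_def,
    smul_eq_mul, smul_eq_mul, mul_left_comm]
  gcongr

variable {μ} in
theorem setIntegral_det_one_add_fderiv {h : E → E} {K : NNReal} (hK : LipschitzWith K h)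
    (hK1 : K < 1) (hpos : ∀ A : E →L[ℝ] E, ‖A‖ ≤ K → 0 < (1 + A).det) {B : Set E}
    (hB : MeasurableSet B) (hsupp : ∀ x ∉ B, h x = 0) :
    ∫ x in B, (1 + fderiv ℝ h x).det ∂μ = μ.real B := by
  let F : E → E := fun x => x + h x
  have hFL : LipschitzWith (1 + K) F := LipschitzWith.id.add hK
  have happ : ApproximatesLinearOn F ((ContinuousLinearEquiv.refl ℝ E : E ≃L[ℝ] E) : E →L[ℝ] E)
      Set.univ K := by
    intro x _ y _
    have e : F x - F y - (x - y) = h x - h y := by simp only [F]; abel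
    simpa [e] using hK.norm_sub_le x y
  have hc : Subsingleton E ∨
      K < ‖((ContinuousLinearEquiv.refl ℝ E : E ≃L[ℝ] E).symm : E →L[ℝ] E)‖₊⁻¹ := by
    rcases subsingleton_or_nontrivial E with hE | hE
    · exact Or.inl hE
    · right
      simpa [ContinuousLinearEquiv.refl_symm, ContinuousLinearEquiv.coe_refl] using hK1
  have hsurj : Function.Surjective F := happ.surjective hc
  have hinj : Function.Injective F := Set.injOn_univ.1 (happ.injOn hc)
  have hoff : ∀ x ∉ B, F x = x := fun x hx => by simp [F, hsupp x hx]
  let D := {x | DifferentiableAt ℝ h x}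
  have hD : MeasurableSet D := measurableSet_of_differentiableAt ℝ h
  have hDae : μ Dᶜ = 0 := hK.ae_differentiableAt
  have himg : F '' B = B := by
    apply Set.Subset.antisymm
    · rintro _ ⟨x, hx, rfl⟩
      by_contra hFx
      have := hinj (hoff _ hFx)
      exact hFx (this.symm ▸ hx)
    · intro y hy
      obtain ⟨x, rfl⟩ := hsurj y
      by_cases hx : x ∈ B
      · exact ⟨x, hx, rfl⟩
      · rw [hoff x hx] at hy
        exact absurd hy hx
  have hderiv : ∀ x ∈ B ∩ D,
      HasFDerivWithinAt F (1 + fderiv ℝ h x) (B ∩ D) x := fun x hx =>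
    ((hasFDerivAt_id x).add hx.2.hasFDerivAt).hasFDerivWithinAt
  have key := integral_image_eq_integral_abs_det_fderiv_smul μ (hB.inter hD) hderiv
    hinj.injOn (fun _ => (1 : ℝ))
  have hBD : (B ∩ D : Set E) =ᵐ[μ] B := by
    have : D =ᵐ[μ] Set.univ := by
      rwa [ae_eq_univ]
    simpa using (ae_eq_refl B).inter this
  have hFBD : (F '' (B ∩ D) : Set E) =ᵐ[μ] B := by
    refine (Set.image_mono Set.inter_subset_left |>.trans himg.subset).eventuallyLE.antisymm ?_
    rw [ae_le_set]
    refine measure_mono_null (t := F '' Dᶜ) ?_ ?_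
    · rintro y ⟨hy, hy'⟩
      rw [← himg] at hy
      obtain ⟨x, hx, rfl⟩ := hy
      exact ⟨x, fun hxD => hy' ⟨x, ⟨hx, hxD⟩, rfl⟩, rfl⟩
    · refine le_antisymm ((hFL.lipschitzOnWith.addHaar_image_le μ).trans ?_) bot_le
      rw [hDae, mul_zero]
  rw [setIntegral_congr_set hFBD, setIntegral_congr_set hBD] at key
  simp only [smul_eq_mul, mul_one, integral_const, MeasurableSet.univ, measureReal_restrict_apply,
    Set.univ_inter] at key
  rw [key]
  refine integral_congr_ae (ae_of_all _ fun x => ?_)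
  exact (abs_of_pos (hpos _ (norm_fderiv_le_of_lipschitz ℝ hK))).symm

variable {μ} in
/-- The Jacobian determinant of a compactly supported Lipschitz map has integral zero. -/
theorem LipschitzWith.integral_det_fderiv_eq_zero [Nontrivial E] {h : E → E} {K : NNReal}
    (hK : LipschitzWith K h) (hsupp : HasCompactSupport h) :
    ∫ x, (fderiv ℝ h x).det ∂μ = 0 := by
  classical
  have hd : 0 < Module.finrank ℝ E := Module.finrank_pos
  let B := tsupport h
  have hBm : MeasurableSet B := (isClosed_tsupport h).measurableSet
  have hBfin : μ B ≠ ⊤ := hsupp.isCompact.measure_ne_top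
  obtain ⟨δ, hδ, hpos⟩ := exists_pos_forall_det_one_add_pos (E := E)
  obtain ⟨a, ha, ha1⟩ : ∃ a > 0, ∀ t : ℝ, 0 ≤ t → t ≤ a * Module.finrank ℝ E →
      t * K < min δ 1 := by
    have hm : 0 < min δ 1 := lt_min hδ one_pos
    refine ⟨min δ 1 / (2 * (Module.finrank ℝ E * (K + 1))), by positivity, fun t ht0 ht => ?_⟩
    have hK0 : (0 : ℝ) ≤ K := K.2
    calc t * K ≤ t * (K + 1) := by nlinarith
      _ ≤ min δ 1 / (2 * (Module.finrank ℝ E * (K + 1))) * Module.finrank ℝ E * (K + 1) := by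
        gcongr
      _ = min δ 1 / 2 := by field_simp
      _ < _ := by linarith
  let s : Finset ℝ := (Finset.range (Module.finrank ℝ E + 1)).image fun i : ℕ => a * i
  have hs : s.card = Module.finrank ℝ E + 1 := by
    rw [Finset.card_image_of_injective, Finset.card_range]
    intro i j hij
    exact_mod_cast mul_left_cancel₀ ha.ne' hij
  have hst : ∀ t ∈ s, 0 ≤ t ∧ t * K < min δ 1 := by
    intro t ht
    obtain ⟨i, hi, rfl⟩ := Finset.mem_image.1 ht
    have hi' : i ≤ Module.finrank ℝ E := Nat.lt_succ_iff.1 (Finset.mem_range.1 hi)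
    have h0 : (0 : ℝ) ≤ a * i := by positivity
    exact ⟨h0, ha1 _ h0 (by gcongr)⟩
  have hint : ∀ t ∈ s, ∫ x in B, (1 + t • fderiv ℝ h x).det ∂μ = μ.real B := by
    intro t ht
    obtain ⟨ht0, htK⟩ := hst t ht
    have hL : LipschitzWith (t.toNNReal * K) (fun x => t • h x) := by
      have := (lipschitzWith_smul t).comp hK
      rwa [show ‖t‖₊ = t.toNNReal from by
        ext; simp [abs_of_nonneg ht0, ht0]] at this
    have hcoe : ((t.toNNReal * K : NNReal) : ℝ) = t * K := by simp [ht0]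
    rw [← setIntegral_det_one_add_fderiv (μ := μ) hL ?_ ?_ hBm ?_]
    · refine integral_congr_ae ?_
      filter_upwards [ae_restrict_of_ae (hK.ae_differentiableAt (μ := μ))] with x hx
      rw [fderiv_fun_const_smul hx]
    · rw [← NNReal.coe_lt_coe, hcoe]
      exact htK.trans_le (min_le_right _ _)
    · intro A hA
      exact hpos A (hA.trans_lt (hcoe ▸ htK.trans_le (min_le_left _ _)))
    · intro x hx
      rw [image_eq_zero_of_notMem_tsupport hx, smul_zero]
  have hzero : ∫ x, (fderiv ℝ h x).det ∂μ = ∫ x in B, (fderiv ℝ h x).det ∂μ := by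
    refine (setIntegral_eq_integral_of_forall_compl_eq_zero fun x hx => ?_).symm
    rw [fderiv_of_notMem_tsupport (𝕜 := ℝ) hx]
    simp [ContinuousLinearMap.det]
  have hexp : ∀ A : E →L[ℝ] E,
      A.det = ∑ t ∈ s, (1 + t • A).det / ∏ u ∈ s.erase t, (t - u) := fun A =>
    det_eq_sum_det_one_add_smul hs A
  have hw : (0 : ℝ) = ∑ t ∈ s, 1 / ∏ u ∈ s.erase t, (t - u) := by
    have := hexp 0
    simpa [ContinuousLinearMap.det, hd.ne'] using this
  rw [hzero]
  calc ∫ x in B, (fderiv ℝ h x).det ∂μ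
      = ∫ x in B, ∑ t ∈ s, (1 + t • fderiv ℝ h x).det / ∏ u ∈ s.erase t, (t - u) ∂μ := by
        simp_rw [← hexp]
    _ = ∑ t ∈ s, ∫ x in B, (1 + t • fderiv ℝ h x).det / ∏ u ∈ s.erase t, (t - u) ∂μ := by
        refine integral_finsetSum _ fun t _ => Integrable.div_const ?_ _
        refine integrableOn_det μ (C := 1 + ‖t‖ * K)
          (measurable_const.add ((measurable_fderiv ℝ h).const_smul t)) (fun x => ?_) hBfin
        refine (norm_add_le _ _).trans (add_le_add ?_ ?_)
        · exact ContinuousLinearMap.norm_id_le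
        · rw [Pi.smul_apply, norm_smul]
          gcongr
          exact norm_fderiv_le_of_lipschitz ℝ hK
    _ = ∑ t ∈ s, μ.real B * (1 / ∏ u ∈ s.erase t, (t - u)) := by
        refine Finset.sum_congr rfl fun t ht => ?_
        rw [integral_div, hint t ht, mul_one_div]
    _ = 0 := by rw [← Finset.mul_sum, ← hw, mul_zero]


variable {μ} in
theorem LipschitzWith.setIntegral_fderiv_comp_mul_det_eq_zero [Nontrivial E] {f : E → E}
    {K : NNReal} (hf : LipschitzWith K f) (hfc : HasCompactSupport f) {q : E} {R : ℝ} (hR : 0 < R)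
    {ψ : E → ℝ} (hψ : ContDiff ℝ 1 ψ) (hψc : HasCompactSupport ψ)
    (hsub : ∀ x ∈ closedBall q R, ψ (f x) ≠ 0 → x ∈ closedBall q (R / 2)) (v : E) :
    ∫ x in ball q R, fderiv ℝ ψ (f x) v * (fderiv ℝ f x).det ∂μ = 0 := by
  obtain ⟨C, hC⟩ := ContDiff.lipschitzWith_of_hasCompactSupport hψc hψ one_ne_zero
  obtain ⟨M, hM⟩ := hψ.continuous.bounded_above_of_compact_support hψc
  let η : E → E := (ball q R).indicator fun x => ψ (f x) • v
  have hη0 : ∀ x ∉ closedBall q (R / 2), η x = 0 := by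
    intro x hx
    by_cases hxR : x ∈ ball q R
    · have : ψ (f x) = 0 := by
        by_contra h
        exact hx (hsub x (ball_subset_closedBall hxR) h)
      simp [η, this]
    · exact Set.indicator_of_notMem hxR _
  have hηc : HasCompactSupport η :=
    HasCompactSupport.intro (isCompact_closedBall q (R / 2)) hη0
  have hηL : ∃ C', LipschitzWith C' η := by
    have hbd : ∀ x ∈ Set.univ, ‖η x‖ ≤ M * ‖v‖ := by
      intro x _
      refine (norm_indicator_le_norm_self _ _).trans ?_
      rw [norm_smul]
      gcongr
      exact hM _
    have hloc : ∀ x y, x ∈ closedBall q (R / 2) → dist x y < R / 2 →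
        dist (η x) (η y) ≤ C * K * ‖v‖ * dist x y := by
      intro x y hx hxy
      have hxR : x ∈ ball q R := by
        rw [mem_closedBall] at hx; rw [mem_ball]; linarith
      have hyR : y ∈ ball q R := by
        rw [mem_closedBall] at hx; rw [mem_ball]
        linarith [dist_triangle_left y q x]
      simp only [η, Set.indicator_of_mem hxR, Set.indicator_of_mem hyR]
      rw [dist_eq_norm, ← sub_smul, norm_smul, ← dist_eq_norm]
      calc dist (ψ (f x)) (ψ (f y)) * ‖v‖ ≤ (C * (K * dist x y)) * ‖v‖ := by
            gcongr
            exact (hC.dist_le_mul _ _).trans (by gcongr; exact hf.dist_le_mul _ _)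
        _ = _ := by ring
    obtain ⟨C', hC'⟩ := exists_lipschitzOnWith_of_bounded_of_small_dist (half_pos hR) hbd
      (K := C * K * ‖v‖) (by
        intro x _ y _ hxy
        by_cases hx : x ∈ closedBall q (R / 2)
        · exact hloc x y hx hxy
        by_cases hy : y ∈ closedBall q (R / 2)
        · rw [dist_comm, dist_comm x y]
          exact hloc y x hy (dist_comm x y ▸ hxy)
        · rw [hη0 x hx, hη0 y hy, dist_self]
          positivity)
    exact ⟨C', lipschitzOnWith_univ.1 hC'⟩
  obtain ⟨C', hC'⟩ := hηL
  have hsumL : LipschitzWith (K + C') (f + η) := hf.add hC'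
  have e1 := hsumL.integral_det_fderiv_eq_zero (μ := μ) (hfc.add hηc)
  have e2 := hf.integral_det_fderiv_eq_zero (μ := μ) hfc
  have hint : ∀ {g : E → E} {C : NNReal}, LipschitzWith C g → HasCompactSupport g →
      Integrable (fun x => (fderiv ℝ g x).det) μ := by
    intro g C hg hgc
    rw [← integrableOn_iff_integrable_of_support_subset (s := tsupport g)]
    · exact integrableOn_det μ (measurable_fderiv ℝ g)
        (fun x => norm_fderiv_le_of_lipschitz ℝ hg) hgc.isCompact.measure_ne_top
    · intro x hx
      by_contra hxg
      apply hx
      simp only [fderiv_of_notMem_tsupport (𝕜 := ℝ) hxg]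
      simp [ContinuousLinearMap.det]
  have e3 := integral_sub (hint hsumL (hfc.add hηc)) (hint hf hfc)
  rw [e1, e2, sub_zero] at e3
  rw [← integral_indicator measurableSet_ball, ← e3]
  refine integral_congr_ae ?_
  filter_upwards [hf.ae_differentiableAt (μ := μ)] with x hx
  by_cases hxR : x ∈ ball q R
  · rw [Set.indicator_of_mem hxR]
    have hη : HasFDerivAt η (((fderiv ℝ ψ (f x)).comp (fderiv ℝ f x)).smulRight v) x := by
      have h1 : HasFDerivAt (fun x => ψ (f x) • v)
          (((fderiv ℝ ψ (f x)).comp (fderiv ℝ f x)).smulRight v) x :=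
        ((hψ.differentiable one_ne_zero (f x)).hasFDerivAt.comp x hx.hasFDerivAt).smul_const v
      refine h1.congr_of_eventuallyEq ?_
      filter_upwards [isOpen_ball.mem_nhds hxR] with y hy
      exact Set.indicator_of_mem hy _
    rw [(hx.hasFDerivAt.add hη).fderiv, det_add_comp_smulRight]
    ring
  · rw [Set.indicator_of_notMem hxR]
    have hη : f + η =ᶠ[𝓝 x] f := by
      have hx2 : x ∈ (closedBall q (R / 2))ᶜ := by
        intro h
        exact hxR (closedBall_subset_ball (half_lt_self hR) h)
      filter_upwards [isClosed_closedBall.isOpen_compl.mem_nhds hx2] with y hy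
      rw [Pi.add_apply, hη0 y hy, add_zero]
    rw [hη.fderiv_eq, sub_self]

/-- A Lipschitz map with Lipschitz inverse on a closed ball covers almost all of a neighbourhood of
the image of the centre. -/
theorem LipschitzWith.exists_ball_diff_image_null [Nontrivial E] {f : E → E}
    {K : NNReal} (hf : LipschitzWith K f) (hfc : HasCompactSupport f) {q : E} {R L : ℝ}
    (hR : 0 < R) (hL : 0 < L)
    (hinv : ∀ x ∈ closedBall q R, ∀ y ∈ closedBall q R, dist x y ≤ L * dist (f x) (f y)) :
    ∃ ρ > 0, μ (ball (f q) ρ \ f '' ball q R) = 0 := by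
  have hinj : Set.InjOn f (closedBall q R) := by
    intro x hx y hy hxy
    have := hinv x hx y hy
    rw [hxy, dist_self, mul_zero] at this
    exact dist_le_zero.1 this
  have hq : q ∈ closedBall q R := mem_closedBall_self hR.le
  let D := {x | DifferentiableAt ℝ f x}
  let S := ball q R ∩ D
  have hSm : MeasurableSet S := measurableSet_ball.inter (measurableSet_of_differentiableAt ℝ f)
  have hSB : S ⊆ closedBall q R := Set.inter_subset_left.trans ball_subset_closedBall
  have hSinj : Set.InjOn f S := hinj.mono hSB
  have hDae : ∀ᵐ x ∂μ, x ∈ D := hf.ae_differentiableAt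
  have hSae : (S : Set E) =ᵐ[μ] ball q R := by
    filter_upwards [hDae] with x hx
    exact propext (and_iff_left hx)
  have hSd : ∀ x ∈ S, HasFDerivWithinAt f (fderiv ℝ f x) S x := fun x hx =>
    hx.2.hasFDerivAt.hasFDerivWithinAt
  have hfSm : MeasurableSet (f '' S) :=
    hSm.image_of_continuousOn_injOn hf.continuous.continuousOn hSinj
  let g := Function.invFunOn f S
  have hg : ∀ x ∈ S, g (f x) = x := hSinj.leftInvOn_invFunOn
  let s : E → ℝ := fun y => SignType.sign (fderiv ℝ f (g y)).det
  let σ : E → ℝ := (f '' S).indicator s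
  have hσ : Integrable σ μ := by
    rw [integrable_indicator_iff hfSm,
      integrableOn_image_iff_integrableOn_abs_det_fderiv_smul μ hSm hSd hSinj]
    refine (integrableOn_det μ (measurable_fderiv ℝ f)
      (fun x => norm_fderiv_le_of_lipschitz ℝ hf) ?_).congr_fun (fun x hx => ?_) hSm
    · exact ((measure_mono Set.inter_subset_left).trans_lt measure_ball_lt_top).ne
    · simp only [s, hg x hx, smul_eq_mul, abs_mul_sign]
  have hΛ : ∀ φ : E → ℝ, ∫ y, φ y * σ y ∂μ =
      ∫ x in ball q R, φ (f x) * (fderiv ℝ f x).det ∂μ := by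
    intro φ
    have e : (fun y => φ y * σ y) = (f '' S).indicator fun y => φ y * s y := by
      ext y
      by_cases hy : y ∈ f '' S <;> simp [σ, hy]
    rw [e, integral_indicator hfSm,
      integral_image_eq_integral_abs_det_fderiv_smul μ hSm hSd hSinj, ← setIntegral_congr_set hSae]
    refine setIntegral_congr_fun hSm fun x hx => ?_
    simp only [s, hg x hx, smul_eq_mul]
    rw [mul_left_comm, abs_mul_sign]
  let ρ := R / (4 * L)
  have hρ : 0 < ρ := by positivity
  have hconst : ∀ φ : ContDiffBump (0 : E), φ.rOut < ρ → ∀ y ∈ ball (f q) ρ, ∀ z ∈ ball (f q) ρ,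
      convolution (φ.normed μ) σ (ContinuousLinearMap.lsmul ℝ ℝ) μ y =
      convolution (φ.normed μ) σ (ContinuousLinearMap.lsmul ℝ ℝ) μ z := by
    intro φ hφ y hy z hz
    have hφs : ContDiff ℝ 1 (φ.normed μ) := φ.contDiff_normed
    have hder := fun x => φ.hasCompactSupport_normed.hasFDerivAt_convolution_left
      (ContinuousLinearMap.lsmul ℝ ℝ) hφs hσ.locallyIntegrable x
    refine isOpen_ball.is_const_of_fderiv_eq_zero (𝕜 := ℝ) (convex_ball (f q) ρ).isPreconnected
      (fun x _ => (hder x).differentiableAt.differentiableWithinAt) (fun x hx => ?_) hy hz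
    rw [(hder x).fderiv]
    ext v
    have hcint : ConvolutionExists (fderiv ℝ (φ.normed μ)) σ
        (ContinuousLinearMap.precompL E (ContinuousLinearMap.lsmul ℝ ℝ)) μ :=
      (φ.hasCompactSupport_normed.fderiv (𝕜 := ℝ)).convolutionExists_left _
        (hφs.continuous_fderiv one_ne_zero) hσ.locallyIntegrable
    rw [convolution_def, ContinuousLinearMap.integral_apply (hcint x)]
    simp only [ContinuousLinearMap.precompL_apply, ContinuousLinearMap.lsmul_apply, smul_eq_mul,
      Pi.zero_apply, _root_.zero_apply]
    rw [← integral_sub_left_eq_self _ μ x]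
    simp only [sub_sub_cancel]
    let ψ : E → ℝ := fun w => φ.normed μ (x - w)
    have hψs : ContDiff ℝ 1 ψ := hφs.comp (contDiff_const.sub contDiff_id)
    have hψc : HasCompactSupport ψ :=
      φ.hasCompactSupport_normed.comp_homeomorph (Homeomorph.subLeft x)
    have hψd : ∀ w, fderiv ℝ (φ.normed μ) (x - w) v = - fderiv ℝ ψ w v := by
      intro w
      have h1 : HasFDerivAt ψ ((fderiv ℝ (φ.normed μ) (x - w)).comp
          (-ContinuousLinearMap.id ℝ E)) w :=
        ((hφs.differentiable one_ne_zero (x - w)).hasFDerivAt).comp w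
          ((hasFDerivAt_id w).const_sub x)
      rw [h1.fderiv]
      simp
    simp only [hψd]
    rw [hΛ fun w => -(fderiv ℝ ψ w) v]
    simp only [neg_mul]
    rw [integral_neg, hf.setIntegral_fderiv_comp_mul_det_eq_zero hfc hR hψs hψc, neg_zero]
    intro w hw hψw
    have h1 : x - f w ∈ ball (0 : E) φ.rOut := by
      rw [← φ.support_normed_eq (μ := μ)]
      exact hψw
    rw [mem_ball_zero_iff, ← dist_eq_norm] at h1
    rw [mem_ball] at hx
    have h2 : dist (f w) (f q) ≤ 2 * ρ := by
      linarith [dist_triangle_left (f w) (f q) x]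
    rw [mem_closedBall]
    calc dist w q ≤ L * dist (f w) (f q) := hinv w hw q hq
      _ ≤ L * (2 * ρ) := by gcongr
      _ = R / 2 := by simp only [ρ]; field_simp; norm_num
  let φ : ℕ → ContDiffBump (0 : E) := fun n =>
    ⟨1 / (n + 1), 2 * (1 / (n + 1)), by positivity, by
      have : (0 : ℝ) < 1 / (n + 1) := by positivity
      linarith⟩
  have hφ0 : Tendsto (fun n => (φ n).rOut) atTop (𝓝 0) := by
    simpa only [mul_zero] using (tendsto_one_div_add_atTop_nhds_zero_nat (𝕜 := ℝ)).const_mul 2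
  have hlim := ContDiffBump.ae_convolution_tendsto_right_of_locallyIntegrable (μ := μ) (K := 2)
    hφ0 (Eventually.of_forall fun n => le_rfl) hσ.locallyIntegrable
  have hpos : μ (ball (f q) ρ) ≠ 0 := (measure_ball_pos μ _ hρ).ne'
  obtain ⟨c, hc⟩ : ∃ c, ∀ᵐ y ∂μ, y ∈ ball (f q) ρ → σ y = c := by
    obtain ⟨y, hy, hylim⟩ :=
      (frequently_ae_mem_iff.2 hpos).and_eventually hlim |>.exists
    refine ⟨σ y, ?_⟩
    filter_upwards [hlim] with z hzlim hz
    refine tendsto_nhds_unique hzlim (hylim.congr' ?_)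
    filter_upwards [hφ0.eventually (gt_mem_nhds hρ)] with n hn
    exact hconst _ hn y hy z hz
  refine ⟨ρ, hρ, ?_⟩
  have hc0 : c ≠ 0 := by
    rintro rfl
    let T := S ∩ f ⁻¹' ball (f q) ρ
    let Z := {x | (fderiv ℝ f x).det = 0}
    have hZ : μ (f '' (T ∩ Z)) = 0 :=
      addHaar_image_eq_zero_of_det_fderivWithin_eq_zero μ
        (fun x hx => (hSd x hx.1.1).mono (Set.inter_subset_left.trans Set.inter_subset_left))
        fun x hx => hx.2
    have hZc : μ (f '' (T \ Z)) = 0 := by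
      refine measure_mono_null ?_ hc
      rintro _ ⟨x, hx, rfl⟩ hcon
      have h1 := hcon hx.1.2
      simp only [σ, Set.indicator_of_mem (Set.mem_image_of_mem f hx.1.1), s, hg x hx.1.1] at h1
      apply hx.2
      have h2 := abs_mul_sign (fderiv ℝ f x).det
      rw [h1, mul_zero] at h2
      exact h2.symm
    have hfT : μ (f '' T) = 0 := by
      rw [← Set.inter_union_sdiff T Z, Set.image_union]
      exact measure_union_null hZ hZc
    have hgL : LipschitzOnWith L.toNNReal g (f '' T) := by
      refine LipschitzOnWith.of_dist_le_mul ?_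
      rintro _ ⟨x, hx, rfl⟩ _ ⟨y, hy, rfl⟩
      rw [hg x hx.1, hg y hy.1, Real.coe_toNNReal _ hL.le]
      exact hinv x (hSB hx.1) y (hSB hy.1)
    have hT0 : μ T = 0 := by
      have h1 := hgL.addHaar_image_le μ
      rw [hfT, mul_zero] at h1
      refine measure_mono_null ?_ (le_antisymm h1 bot_le)
      exact fun x hx => ⟨f x, ⟨x, hx, rfl⟩, hg x hx.1⟩
    have hV : IsOpen (ball q R ∩ f ⁻¹' ball (f q) ρ) :=
      isOpen_ball.inter (isOpen_ball.preimage hf.continuous)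
    refine (hV.measure_pos μ ⟨q, mem_ball_self hR, mem_ball_self hρ⟩).ne' ?_
    rw [← hT0]
    exact measure_congr (hSae.symm.inter (ae_eq_refl _))
  refine measure_mono_null ?_ hc
  intro y hy hcon
  refine hc0 ((hcon hy.1).symm.trans (Set.indicator_of_notMem (fun h => hy.2 ?_) _))
  exact Set.image_mono Set.inter_subset_left h

theorem exists_ball_diff_image_null_of_biLipschitz [Nontrivial E] {f : E → E} {Ω : Set E}
    (hΩ : IsOpen Ω) {K : NNReal} (hf : LipschitzOnWith K f Ω) {L : ℝ} (hL : 0 < L)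
    (hinv : ∀ x ∈ Ω, ∀ y ∈ Ω, dist x y ≤ L * dist (f x) (f y)) {q : E} (hq : q ∈ Ω) :
    ∃ ρ > 0, μ (ball (f q) ρ \ f '' Ω) = 0 := by
  classical
  obtain ⟨R, hR, hRΩ⟩ := nhds_basis_closedBall.mem_iff.1 (hΩ.mem_nhds hq)
  let u : E → E := (closedBall q R).indicator f
  have hu1 : ∀ x ∈ closedBall q R, u x = f x := fun x hx => Set.indicator_of_mem hx f
  have hu0 : ∀ x ∉ closedBall q R, u x = 0 := fun x hx => Set.indicator_of_notMem hx f
  have hu : ∃ C : NNReal, LipschitzOnWith C u (closedBall q R ∪ (ball q (R + 1))ᶜ) := by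
    refine exists_lipschitzOnWith_of_bounded_of_small_dist (K := K) (M := ‖f q‖ + K * R) one_pos
      ?_ ?_
    · intro x _
      by_cases hx : x ∈ closedBall q R
      · rw [hu1 x hx]
        have h1 := hf.dist_le_mul x (hRΩ hx) q hq
        have h2 : (K : ℝ) * dist x q ≤ K * R := mul_le_mul_of_nonneg_left hx K.2
        rw [dist_eq_norm] at h1
        linarith [norm_sub_norm_le (f x) (f q)]
      · rw [hu0 x hx, norm_zero]
        positivity
    · have hsep : ∀ x ∈ closedBall q R, ∀ y ∉ ball q (R + 1), 1 ≤ dist x y := by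
        intro x hx y hy
        rw [mem_closedBall] at hx
        rw [mem_ball, not_lt] at hy
        linarith [dist_triangle_left y q x]
      have hnot : ∀ x ∉ ball q (R + 1), x ∉ closedBall q R := fun x hx hx' =>
        hx (closedBall_subset_ball (by linarith) hx')
      rintro x (hx | hx) y (hy | hy) hxy
      · rw [hu1 x hx, hu1 y hy]
        exact hf.dist_le_mul x (hRΩ hx) y (hRΩ hy)
      · exact absurd hxy (not_lt.2 (hsep x hx y hy))
      · exact absurd hxy (not_lt.2 (dist_comm x y ▸ hsep y hy x hx))
      · rw [hu0 x (hnot x hx), hu0 y (hnot y hy), dist_self]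
        positivity
  obtain ⟨C, hC⟩ := hu
  obtain ⟨h, hh, heq⟩ := hC.extend_finite_dimension
  have hhf : Set.EqOn h f (closedBall q R) := fun x hx => by
    rw [← heq (Or.inl hx)]
    exact hu1 x hx
  have hhc : HasCompactSupport h := by
    refine HasCompactSupport.intro (isCompact_closedBall q (R + 1)) fun x hx => ?_
    rw [← heq (Or.inr fun hx' => hx (ball_subset_closedBall hx'))]
    exact hu0 x fun hx' => hx (closedBall_subset_closedBall (by linarith) hx')
  obtain ⟨ρ, hρ, hnull⟩ := hh.exists_ball_diff_image_null μ hhc hR hL (q := q) (by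
    intro x hx y hy
    rw [hhf hx, hhf hy]
    exact hinv x (hRΩ hx) y (hRΩ hy))
  refine ⟨ρ, hρ, ?_⟩
  rw [hhf (mem_closedBall_self hR.le), (hhf.mono ball_subset_closedBall).image_eq] at hnull
  exact measure_mono_null
    (Set.sdiff_subset_sdiff_right (Set.image_mono (ball_subset_closedBall.trans hRΩ))) hnull

omit [BorelSpace E] in
theorem tendsto_density_one_iff {X : Set E} (hX : MeasurableSet X) {q : E} :
    Tendsto (fun r : ℝ => μ (X ∩ ball q r) / μ (ball q r)) (𝓝[>] 0) (𝓝 1) ↔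
      Tendsto (fun r : ℝ => μ (ball q r \ X) / μ (ball q r)) (𝓝[>] 0) (𝓝 0) := by
  have hadd : ∀ r > 0, μ (X ∩ ball q r) / μ (ball q r) + μ (ball q r \ X) / μ (ball q r) = 1 := by
    intro r hr
    rw [ENNReal.div_add_div_same, Set.inter_comm, measure_inter_add_sdiff _ hX]
    exact ENNReal.div_self (measure_ball_pos μ q hr).ne' measure_ball_lt_top.ne
  have hsub : ∀ {u v : ℝ → ENNReal} {a : ENNReal}, (∀ r > 0, u r + v r = 1) →
      Tendsto u (𝓝[>] 0) (𝓝 a) → Tendsto v (𝓝[>] 0) (𝓝 (1 - a)) := by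
    intro u v a huv hu
    refine (ENNReal.Tendsto.sub tendsto_const_nhds hu (Or.inl ENNReal.one_ne_top)).congr' ?_
    filter_upwards [self_mem_nhdsWithin] with r hr
    have h1 := huv r hr
    refine ENNReal.sub_eq_of_eq_add ?_ (by rw [add_comm, h1])
    exact ((h1 ▸ le_self_add : u r ≤ 1).trans_lt ENNReal.one_lt_top).ne
  constructor
  · intro h
    simpa using hsub hadd h
  · intro h
    simpa using hsub (fun r hr => (add_comm _ _).trans (hadd r hr)) h

theorem tendsto_density_of_ball_diff_le_image [Nontrivial E] {X Y V : Set E}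
    (hX : MeasurableSet X) (hY : MeasurableSet Y) {g : E → E} {L : NNReal}
    (hg : LipschitzOnWith L g V) {p q : E} {M : ℝ} (hM : 0 < M)
    (hsub : ∀ᶠ r in 𝓝[>] (0 : ℝ), (ball p r \ Y : Set E) ≤ᵐ[μ] g '' (V ∩ (ball q (M * r) \ X)))
    (h : Tendsto (fun r : ℝ => μ (X ∩ ball q r) / μ (ball q r)) (𝓝[>] 0) (𝓝 1)) :
    Tendsto (fun r : ℝ => μ (Y ∩ ball p r) / μ (ball p r)) (𝓝[>] 0) (𝓝 1) := by
  rw [tendsto_density_one_iff μ hX] at h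
  rw [tendsto_density_one_iff μ hY]
  have hMr : Tendsto (fun r : ℝ => M * r) (𝓝[>] 0) (𝓝[>] 0) := by
    refine tendsto_nhdsWithin_iff.2 ⟨?_, ?_⟩
    · have : Tendsto (fun r : ℝ => M * r) (𝓝 0) (𝓝 (M * 0)) := tendsto_id.const_mul M
      rw [mul_zero] at this
      exact this.mono_left nhdsWithin_le_nhds
    · filter_upwards [self_mem_nhdsWithin] with r hr
      exact mul_pos hM hr
  let d := Module.finrank ℝ E
  let c : ENNReal := (L : ENNReal) ^ d * ENNReal.ofReal (M ^ d)
  have hc : c ≠ ⊤ := ENNReal.mul_ne_top (ENNReal.pow_ne_top ENNReal.coe_ne_top)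
    ENNReal.ofReal_ne_top
  have hlim := ENNReal.Tendsto.const_mul (h.comp hMr) (Or.inr hc)
  rw [mul_zero] at hlim
  refine tendsto_of_tendsto_of_tendsto_of_le_of_le' tendsto_const_nhds hlim
    (Eventually.of_forall fun _ => zero_le) ?_
  filter_upwards [hsub, self_mem_nhdsWithin] with r hr hr0
  rw [Set.mem_Ioi] at hr0
  have hball : μ (ball q (M * r)) = ENNReal.ofReal (M ^ d) * μ (ball p r) := by
    rw [Measure.addHaar_ball_mul μ q hM.le, Measure.addHaar_ball_center μ p]
  have hm0 : ENNReal.ofReal (M ^ d) ≠ 0 := by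
    simp only [ne_eq, ENNReal.ofReal_eq_zero, not_le]
    positivity
  have hle : μ (ball p r \ Y) ≤ (L : ENNReal) ^ d * μ (ball q (M * r) \ X) :=
    (measure_mono_ae hr).trans (((hg.mono Set.inter_subset_left).addHaar_image_le μ).trans
      (by gcongr; exact Set.inter_subset_right))
  simp only [Function.comp_apply]
  rw [hball]
  calc μ (ball p r \ Y) / μ (ball p r)
      ≤ (L : ENNReal) ^ d * μ (ball q (M * r) \ X) / μ (ball p r) := by gcongr
    _ = _ := by
      rw [← ENNReal.mul_div_mul_left _ _ hm0 ENNReal.ofReal_ne_top]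
      simp only [c, div_eq_mul_inv]
      ring

end LipschitzDegree

/-- For a bi-Lipschitz map `f` on an open set `Ω ⊆ ℝ^n` and a measurable `A ⊆ Ω` with
`f(A)` measurable, a point `q ∈ A` is a full-density point of `A` if and only if
`f(q)` is a full-density point of `f(A)`. -/
theorem stmt_2 (n : ℕ) (Ω : Set (EuclideanSpace ℝ (Fin n))) (hΩ : IsOpen Ω)
    (f : EuclideanSpace ℝ (Fin n) → EuclideanSpace ℝ (Fin n))
    (hinj : Set.InjOn f Ω)
    (hf : ∃ K : NNReal, LipschitzOnWith K f Ω)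
    (hinv : ∃ K' : ℝ, ∀ x ∈ Ω, ∀ y ∈ Ω, dist x y ≤ K' * dist (f x) (f y))
    (A : Set (EuclideanSpace ℝ (Fin n))) (hAΩ : A ⊆ Ω) (hA : MeasurableSet A)
    (hfA : MeasurableSet (f '' A))
    (q : EuclideanSpace ℝ (Fin n)) (hq : q ∈ A) :
    Tendsto (fun r : ℝ => volume (A ∩ ball q r) / volume (ball q r))
        (𝓝[>] (0 : ℝ)) (𝓝 (1 : ENNReal)) ↔
      Tendsto (fun r : ℝ => volume ((f '' A) ∩ ball (f q) r) / volume (ball (f q) r))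
        (𝓝[>] (0 : ℝ)) (𝓝 (1 : ENNReal)) := by
  rcases Nat.eq_zero_or_pos n with rfl | hn
  · have h1 : A = Set.univ := Set.eq_univ_of_forall fun x => Subsingleton.elim q x ▸ hq
    have h2 : f '' A = Set.univ :=
      Set.eq_univ_of_forall fun x => Subsingleton.elim (f q) x ▸ Set.mem_image_of_mem f hq
    rw [h1] at h2 ⊢
    rw [h2, Subsingleton.elim (f q) q]
  have : Nonempty (Fin n) := ⟨⟨0, hn⟩⟩
  have hqΩ := hAΩ hq
  obtain ⟨K, hK⟩ := hf
  obtain ⟨L, hL, hinv⟩ : ∃ L : ℝ, 0 < L ∧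
      ∀ x ∈ Ω, ∀ y ∈ Ω, dist x y ≤ L * dist (f x) (f y) := by
    obtain ⟨K', hK'⟩ := hinv
    refine ⟨max K' 1, lt_max_of_lt_right one_pos, fun x hx y hy => (hK' x hx y hy).trans ?_⟩
    exact mul_le_mul_of_nonneg_right (le_max_left _ _) dist_nonneg
  constructor
  · intro h
    obtain ⟨ρ, hρ, hnull⟩ := exists_ball_diff_image_null_of_biLipschitz volume hΩ hK hL hinv hqΩ
    refine tendsto_density_of_ball_diff_le_image volume hA hfA hK hL ?_ h
    filter_upwards [Ioo_mem_nhdsGT hρ] with r hr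
    rw [ae_le_set]
    refine measure_mono_null ?_ hnull
    rintro y ⟨⟨hyr, hyA⟩, hy⟩
    refine ⟨ball_subset_ball hr.2.le hyr, ?_⟩
    rintro ⟨x, hx, rfl⟩
    refine hy ⟨x, ⟨hx, ?_, fun hxA => hyA ⟨x, hxA, rfl⟩⟩, rfl⟩
    rw [mem_ball] at hyr ⊢
    exact (hinv x hx q hqΩ).trans_lt (mul_lt_mul_of_pos_left hyr hL)
  · intro h
    have hg := hinj.leftInvOn_invFunOn
    have hgL : LipschitzOnWith L.toNNReal (Function.invFunOn f Ω) (f '' Ω) := by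
      refine LipschitzOnWith.of_dist_le_mul ?_
      rintro _ ⟨x, hx, rfl⟩ _ ⟨y, hy, rfl⟩
      rw [hg hx, hg hy, Real.coe_toNNReal _ hL.le]
      exact hinv x hx y hy
    obtain ⟨ρ, hρ, hball⟩ := Metric.isOpen_iff.1 hΩ q hqΩ
    refine tendsto_density_of_ball_diff_le_image volume hfA hA hgL (M := K + 1) (by positivity)
      ?_ h
    filter_upwards [Ioo_mem_nhdsGT hρ] with r hr
    refine LE.le.eventuallyLE ?_
    rintro x ⟨hxr, hxA⟩
    have hx := hball (ball_subset_ball hr.2.le hxr)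
    refine ⟨f x, ⟨⟨x, hx, rfl⟩, ?_, ?_⟩, hg hx⟩
    · rw [mem_ball] at hxr ⊢
      have h1 := hK.dist_le_mul x hx q hqΩ
      have h2 : (K : ℝ) * dist x q ≤ K * r := mul_le_mul_of_nonneg_left hxr.le K.2
      linarith [hr.1]
    · rintro ⟨z, hz, hzx⟩
      exact hxA (hinj (hAΩ hz) hx hzx ▸ hz)
end

section
/- Let V be a real vector space and let R : V × V × V × V → ℝ be a multilinear map satisfying the curvature symmetries: R(x,y,z,w) = −R(y,x,z,w), R(x,y,z,w) = −R(x,y,w,z), R(x,y,z,w) = R(z,w,x,y), and the first Bianchi identity R(x,y,z,w) + R(x,z,w,y) + R(x,w,y,z) = 0 for all x,y,z,w ∈ V. Then there exists a multilinear map Q : V × V × V × V → ℝ that is symmetric in its first two arguments and symmetric in its last two arguments, such that R(a,b,c,d) = ½ ( Q(a,d,b,c) + Q(b,c,a,d) − Q(a,c,b,d) − Q(b,d,a,c) ) for all a,b,c,d ∈ V; a witness is given (up to sign) by Q(a,b,c,d) = (1/3)(R(a,c,b,d) + R(a,d,b,c)). -/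
/-- Any multilinear map `R` with the curvature-tensor symmetries (antisymmetry in the first
and last pairs, pair symmetry, first Bianchi identity) arises from a multilinear map `Q`
symmetric in its first two and in its last two arguments via
`R(a,b,c,d) = ½ (Q(a,d,b,c) + Q(b,c,a,d) - Q(a,c,b,d) - Q(b,d,a,c))`; a witness is given
(up to sign `ε = ±1`) by `Q(a,b,c,d) = ε · (1/3) (R(a,c,b,d) + R(a,d,b,c))`. -/
theorem stmt_11 (V : Type*) [AddCommGroup V] [Module ℝ V]
    (R : V →ₗ[ℝ] V →ₗ[ℝ] V →ₗ[ℝ] V →ₗ[ℝ] ℝ)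
    (h1 : ∀ x y z w : V, R x y z w = -R y x z w)
    (h2 : ∀ x y z w : V, R x y z w = -R x y w z)
    (h3 : ∀ x y z w : V, R x y z w = R z w x y)
    (hbianchi : ∀ x y z w : V, R x y z w + R x z w y + R x w y z = 0) :
    ∃ (Q : V →ₗ[ℝ] V →ₗ[ℝ] V →ₗ[ℝ] V →ₗ[ℝ] ℝ) (ε : ℝ),
      (ε = 1 ∨ ε = -1) ∧
      (∀ a b c d : V, Q a b c d = Q b a c d) ∧
      (∀ a b c d : V, Q a b c d = Q a b d c) ∧
      (∀ a b c d : V,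
        R a b c d = (1 / 2) * (Q a d b c + Q b c a d - Q a c b d - Q b d a c)) ∧
      (∀ a b c d : V, Q a b c d = ε * (1 / 3) * (R a c b d + R a d b c)) := by
  let S : V →ₗ[ℝ] V →ₗ[ℝ] V →ₗ[ℝ] V →ₗ[ℝ] ℝ := LinearMap.lflip.toLinearMap ∘ₗ R
  let T : V →ₗ[ℝ] V →ₗ[ℝ] V →ₗ[ℝ] V →ₗ[ℝ] ℝ := S.compr₂ LinearMap.lflip.toLinearMap
  have hQ : ∀ a b c d : V,
      ((-(1 / 3) : ℝ) • (S + T)) a b c d = -1 * (1 / 3) * (R a c b d + R a d b c) := by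
    intro a b c d
    simp [S, T]
    ring
  refine ⟨(-(1 / 3) : ℝ) • (S + T), -1, Or.inr rfl, ?_, ?_, ?_, hQ⟩
  · intro a b c d
    rw [hQ, hQ, h3 b c a d, h3 b d a c]
    ring
  · intro a b c d
    rw [hQ, hQ]
    ring
  · intro a b c d
    simp only [hQ]
    linarith [hbianchi a b c d, h2 a b c d, h1 a b c d, h2 b a c d,
      h3 b d c a, h1 c a b d, h2 a c b d, h2 a d c b, h3 b c d a, h1 d a b c]
end
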